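/- Let d ≥ 1, let μ_1, μ_2 ∈ ℝ^d and μ̄_1, μ̄_2 ∈ ℝ^d, and let ρ and ρ̄ be the equally weighted mixtures of two identity-covariance Gaussians with these respective means (k = 2). If the law of ‖X_1 − X_2‖² for X_1, X_2 independent samples from ρ equals the law of the corresponding quantity for ρ̄, then there exists a rigid motion g ∈ E(d) and a permutation σ of {1, 2} with μ̄_i = g(μ_{σ(i)}) for i = 1, 2; the analogous statement holds for k = 3 components: if ρ and ρ̄ are equally weighted mixtures of three identity-covariance Gaussians with means μ_1, μ_2, μ_3 and μ̄_1, μ̄_2, μ̄_3 and equal distance distributions, then there exist g ∈ E(d) and a permutation σ of {1,2,3} with μ̄_i = g(μ_{σ(i)}) for all i. In both cases no genericity assumption on the means is required. -/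

import Mathlib

open MeasureTheory

/-- The Gaussian-mixture density on `ℝ^d` with identity covariances,
weights `w i` and means `μ i`. -/
noncomputable def gaussMixture {d k : ℕ} (w : Fin k → ℝ)
    (μ : Fin k → EuclideanSpace ℝ (Fin d)) : EuclideanSpace ℝ (Fin d) → ℝ := fun x =>
  ∑ i, w i * ((2 * Real.pi) ^ (-(d : ℝ) / 2) * Real.exp (-‖x - μ i‖ ^ 2 / 2))

/-- The distribution of distances of a density `ρ` on `ℝ^d`: the law of
`Δ = ‖X₁ - X₂‖²` where `X₁, X₂` are independent with density `ρ`. -/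
noncomputable def distDistrib {d : ℕ} (ρ : EuclideanSpace ℝ (Fin d) → ℝ) : Measure ℝ :=
  Measure.map
    (fun p : EuclideanSpace ℝ (Fin d) × EuclideanSpace ℝ (Fin d) => ‖p.1 - p.2‖ ^ 2)
    ((volume.withDensity fun x => ENNReal.ofReal (ρ x)).prod
      (volume.withDensity fun x => ENNReal.ofReal (ρ x)))

/-- The unnormalised Gaussian `exp (-a ‖x‖²)` as an extended nonnegative real. -/
noncomputable def gaussBump {d : ℕ} (a : ℝ) (x : EuclideanSpace ℝ (Fin d)) : ENNReal :=
  ENNReal.ofReal (Real.exp (-a * ‖x‖ ^ 2))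

lemma measurable_gaussBump {d : ℕ} (a : ℝ) : Measurable (gaussBump (d := d) a) := by
  unfold gaussBump
  fun_prop

lemma lintegral_gaussBump_ne_top {d : ℕ} {a : ℝ} (ha : 0 < a) :
    ∫⁻ x, gaussBump (d := d) a x ≠ ⊤ := by
  have h : Integrable (fun x : EuclideanSpace ℝ (Fin d) => Real.exp (-a * ‖x‖ ^ 2)) := by
    have h := (GaussianFourier.integrable_cexp_neg_mul_sq_norm_add (b := (a : ℂ)) (by simpa) 0
      (0 : EuclideanSpace ℝ (Fin d))).re
    convert h using 2 with x
    have : -(a : ℂ) * (‖x‖ : ℂ) ^ 2 + 0 * (inner ℝ 0 x : ℝ) = ((-a * ‖x‖ ^ 2 : ℝ) : ℂ) := by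
      push_cast; simp
    rw [this]
    exact (Complex.exp_ofReal_re _).symm
  exact h.lintegral_lt_top.ne

lemma lintegral_gaussBump_ne_zero {d : ℕ} (a : ℝ) :
    ∫⁻ x, gaussBump (d := d) a x ≠ 0 := by
  rw [Ne, lintegral_eq_zero_iff (measurable_gaussBump a)]
  intro h
  have h' : ∀ᵐ _ : EuclideanSpace ℝ (Fin d), False := by
    filter_upwards [h] with x hx
    simp only [gaussBump, Pi.zero_apply, ENNReal.ofReal_eq_zero] at hx
    exact absurd hx (not_le.mpr (Real.exp_pos _))
  exact (NeZero.ne (volume : Measure (EuclideanSpace ℝ (Fin d)))) (by simpa using h')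

/-- Completing the square for a convolution of two Gaussians. -/
lemma lintegral_gaussBump_mul {d : ℕ} {a b : ℝ} (hab : a + b ≠ 0)
    (x m : EuclideanSpace ℝ (Fin d)) :
    ∫⁻ y, gaussBump a (x - y) * gaussBump b (y - m)
      = gaussBump (a * b / (a + b)) (x - m) * ∫⁻ y, gaussBump (d := d) (a + b) y := by
  have key : ∀ y : EuclideanSpace ℝ (Fin d), gaussBump a (x - y) * gaussBump b (y - m)
      = gaussBump (a * b / (a + b)) (x - m)
        * gaussBump (a + b) (y - (m + (a / (a + b)) • (x - m))) := by
    intro y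
    simp only [gaussBump]
    rw [← ENNReal.ofReal_mul (Real.exp_pos _).le, ← ENNReal.ofReal_mul (Real.exp_pos _).le,
      ← Real.exp_add, ← Real.exp_add]
    congr 2
    have h1 : x - y = (x - m) - (y - m) := by abel
    have h2 : y - (m + (a / (a + b)) • (x - m)) = (y - m) - (a / (a + b)) • (x - m) := by abel
    rw [h1, h2, norm_sub_sq_real (x - m), norm_sub_sq_real (y - m), norm_smul, mul_pow, inner_smul_right,
      real_inner_comm, Real.norm_eq_abs, sq_abs]
    field_simp
    ring
  simp_rw [key]
  rw [lintegral_const_mul _ (by have := measurable_gaussBump (d := d) (a + b); fun_prop),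
    lintegral_sub_right_eq_self]

/-- An equally weighted mixture as a sum of scaled Gaussian bumps. -/
lemma ofReal_gaussMixture {d k : ℕ} {w : ℝ} (hw : 0 ≤ w)
    (μ : Fin k → EuclideanSpace ℝ (Fin d)) (x : EuclideanSpace ℝ (Fin d)) :
    ENNReal.ofReal (gaussMixture (fun _ => w) μ x)
      = ∑ i, ENNReal.ofReal (w * (2 * Real.pi) ^ (-(d : ℝ) / 2)) * gaussBump (1 / 2) (x - μ i) := by
  unfold gaussMixture gaussBump
  rw [ENNReal.ofReal_sum_of_nonneg (fun i _ => by positivity)]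
  refine Finset.sum_congr rfl fun i _ => ?_
  rw [← ENNReal.ofReal_mul (by positivity), ← mul_assoc]
  congr 3
  ring

/-- The Laplace transform of the distribution of distances of an equally weighted mixture. -/
lemma lintegral_distDistrib_gaussMixture {d k : ℕ} {w s : ℝ} (hw : 0 ≤ w) (hs : 0 < s)
    (μ : Fin k → EuclideanSpace ℝ (Fin d)) :
    ∫⁻ z, ENNReal.ofReal (Real.exp (-s * z)) ∂distDistrib (gaussMixture (fun _ => w) μ)
      = (ENNReal.ofReal (w * (2 * Real.pi) ^ (-(d : ℝ) / 2)) ^ 2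
          * (∫⁻ y, gaussBump (d := d) (s + 1 / 2) y)
          * ∫⁻ y, gaussBump (d := d) (s * (1 / 2) / (s + 1 / 2) + 1 / 2) y)
        * ∑ i, ∑ j, gaussBump (s / (1 + 4 * s)) (μ i - μ j) := by
  set C := ENNReal.ofReal (w * (2 * Real.pi) ^ (-(d : ℝ) / 2))
  have hm := fun a => measurable_gaussBump (d := d) a
  unfold distDistrib
  simp_rw [ofReal_gaussMixture hw μ]
  have hρ : Measurable fun x => ∑ i, C * gaussBump (1 / 2) (x - μ i) := by
    fun_prop
  rw [lintegral_map (by fun_prop) (by fun_prop), prod_withDensity hρ hρ,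
    lintegral_withDensity_eq_lintegral_mul _ (by fun_prop) (by fun_prop),
    lintegral_prod _ (by fun_prop)]
  have inner_eq : ∀ x : EuclideanSpace ℝ (Fin d),
      ∫⁻ y, (∑ i, C * gaussBump (1 / 2) (x - μ i)) * (∑ j, C * gaussBump (1 / 2) (y - μ j))
          * gaussBump s (x - y)
        = ∑ i, ∑ j, (C ^ 2 * ∫⁻ y, gaussBump (d := d) (s + 1 / 2) y)
            * (gaussBump (s * (1 / 2) / (s + 1 / 2)) (μ j - x) * gaussBump (1 / 2) (x - μ i)) := by
    intro x
    have : ∀ y, (∑ i, C * gaussBump (1 / 2) (x - μ i)) * (∑ j, C * gaussBump (1 / 2) (y - μ j))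
          * gaussBump s (x - y) = ∑ i, ∑ j, (C ^ 2 * gaussBump (1 / 2) (x - μ i))
            * (gaussBump s (x - y) * gaussBump (1 / 2) (y - μ j)) := by
      intro y
      rw [Finset.sum_mul_sum, Finset.sum_mul]
      refine Finset.sum_congr rfl fun i _ => ?_
      rw [Finset.sum_mul]
      refine Finset.sum_congr rfl fun j _ => ?_
      ring
    simp_rw [this]
    rw [lintegral_finsetSum _ (fun i _ => by fun_prop)]
    refine Finset.sum_congr rfl fun i _ => ?_
    rw [lintegral_finsetSum _ (fun i _ => by fun_prop)]
    refine Finset.sum_congr rfl fun j _ => ?_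
    rw [lintegral_const_mul _ (by fun_prop), lintegral_gaussBump_mul (by positivity)]
    have : gaussBump (s * (1 / 2) / (s + 1 / 2)) (μ j - x)
        = gaussBump (s * (1 / 2) / (s + 1 / 2)) (x - μ j) := by
      simp only [gaussBump, norm_sub_rev]
    rw [this]
    ring
  refine (lintegral_congr inner_eq).trans ?_
  rw [lintegral_finsetSum _ (fun i _ => by fun_prop), Finset.mul_sum]
  refine Finset.sum_congr rfl fun i _ => ?_
  rw [lintegral_finsetSum _ (fun i _ => by fun_prop), Finset.mul_sum]
  refine Finset.sum_congr rfl fun j _ => ?_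
  rw [lintegral_const_mul _ (by fun_prop), lintegral_gaussBump_mul (by positivity)]
  have : s * (1 / 2) / (s + 1 / 2) * (1 / 2) / (s * (1 / 2) / (s + 1 / 2) + 1 / 2)
      = s / (1 + 4 * s) := by
    field_simp
    ring
  rw [this, gaussBump, norm_sub_rev, ← gaussBump]
  ring

/-- Equal distance distributions force equal sums of Gaussians of the pairwise distances. -/
lemma sum_exp_eq_of_distDistrib_eq {d k : ℕ} {w t : ℝ} (hw : 0 < w) (ht : 0 < t)
    (ht' : t < 1 / 4) {μ ν : Fin k → EuclideanSpace ℝ (Fin d)}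
    (h : distDistrib (gaussMixture (fun _ => w) μ) = distDistrib (gaussMixture (fun _ => w) ν)) :
    ∑ i, ∑ j, Real.exp (-t * ‖μ i - μ j‖ ^ 2) = ∑ i, ∑ j, Real.exp (-t * ‖ν i - ν j‖ ^ 2) := by
  have h4 : 0 < 1 - 4 * t := by linarith
  obtain ⟨s, hs, hst⟩ : ∃ s, 0 < s ∧ s / (1 + 4 * s) = t := by
    refine ⟨t / (1 - 4 * t), by positivity, ?_⟩
    have : 1 + 4 * (t / (1 - 4 * t)) = 1 / (1 - 4 * t) := by
      field_simp
      ring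
    rw [this, div_div_div_cancel_right₀ h4.ne', div_one]
  have e := lintegral_distDistrib_gaussMixture hw.le hs μ
  rw [h, lintegral_distDistrib_gaussMixture hw.le hs ν, hst] at e
  have hC : ENNReal.ofReal (w * (2 * Real.pi) ^ (-(d : ℝ) / 2)) ≠ 0 := by
    rw [Ne, ENNReal.ofReal_eq_zero, not_le]
    positivity
  rw [ENNReal.mul_right_inj
    (mul_ne_zero (mul_ne_zero (pow_ne_zero _ hC) (lintegral_gaussBump_ne_zero _))
      (lintegral_gaussBump_ne_zero _))
    (ENNReal.mul_ne_top (ENNReal.mul_ne_top (ENNReal.pow_ne_top ENNReal.ofReal_ne_top)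
      (lintegral_gaussBump_ne_top (by positivity))) (lintegral_gaussBump_ne_top (by positivity)))]
    at e
  have conv : ∀ η : Fin k → EuclideanSpace ℝ (Fin d), ∑ i, ∑ j, gaussBump t (η i - η j)
      = ENNReal.ofReal (∑ i, ∑ j, Real.exp (-t * ‖η i - η j‖ ^ 2)) := by
    intro η
    rw [ENNReal.ofReal_sum_of_nonneg (fun i _ => by positivity)]
    refine Finset.sum_congr rfl fun i _ => ?_
    rw [ENNReal.ofReal_sum_of_nonneg (fun i _ => by positivity)]
    rfl
  rw [conv, conv, ENNReal.ofReal_eq_ofReal_iff (by positivity) (by positivity)] at e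
  exact e.symm

/-- Three numbers are determined up to order by their first three power sums. -/
lemma perm_of_power_sums_eq {a b c x y z : ℝ} (h1 : a + b + c = x + y + z)
    (h2 : a ^ 2 + b ^ 2 + c ^ 2 = x ^ 2 + y ^ 2 + z ^ 2)
    (h3 : a ^ 3 + b ^ 3 + c ^ 3 = x ^ 3 + y ^ 3 + z ^ 3) :
    (a = x ∧ b = y ∧ c = z) ∨ (a = x ∧ b = z ∧ c = y) ∨ (a = y ∧ b = x ∧ c = z) ∨
    (a = y ∧ b = z ∧ c = x) ∨ (a = z ∧ b = x ∧ c = y) ∨ (a = z ∧ b = y ∧ c = x) := by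
  have e2 : a * b + b * c + c * a = x * y + y * z + z * x := by
    linear_combination (a + b + c + x + y + z) / 2 * h1 - h2 / 2
  have e3 : a * b * c = x * y * z := by
    linear_combination h3 / 3 - (a ^ 2 + b ^ 2 + c ^ 2 - (a * b + b * c + c * a)) / 3 * h1
      - (x + y + z) / 3 * (h2 - e2)
  have hab : ∀ p q : ℝ, b + c = p + q → b * c = p * q → (b = p ∧ c = q) ∨ (b = q ∧ c = p) := by
    intro p q hs hp
    have : (b - p) * (b - q) = 0 := by linear_combination b * hs - hp
    rcases mul_eq_zero.mp this with h | h
    · exact Or.inl ⟨by linarith, by linarith⟩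
    · exact Or.inr ⟨by linarith, by linarith⟩
  have hroot : (a - x) * ((a - y) * (a - z)) = 0 := by
    linear_combination a ^ 2 * h1 - a * e2 + e3
  rcases mul_eq_zero.mp hroot with h | h
  · obtain rfl : a = x := by linarith
    have hs : b + c = y + z := by linarith
    have := hab y z hs (by linear_combination e2 - a * hs)
    tauto
  rcases mul_eq_zero.mp h with h | h
  · obtain rfl : a = y := by linarith
    have hs : b + c = x + z := by linarith
    have := hab x z hs (by linear_combination e2 - a * hs)
    tauto
  · obtain rfl : a = z := by linarith
    have hs : b + c = x + y := by linarith
    have := hab x y hs (by linear_combination e2 - a * hs)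
    tauto

/-- Side-side-side congruence, realised by a global isometry. -/
lemma exists_isometryEquiv_of_norm_sub_eq {E : Type*} [NormedAddCommGroup E]
    [InnerProductSpace ℝ E] {p q r p' q' r' : E} (hpq : ‖q - p‖ = ‖q' - p'‖)
    (hpr : ‖r - p‖ = ‖r' - p'‖) (hqr : ‖q - r‖ = ‖q' - r'‖) :
    ∃ g : E ≃ᵢ E, g p = p' ∧ g q = q' ∧ g r = r' := by
  set R := (ℝ ∙ ((q - p) - (q' - p')))ᗮ.reflection
  have hR : R (q - p) = q' - p' := Submodule.reflection_sub hpq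
  set S := (ℝ ∙ (R (r - p) - (r' - p')))ᗮ.reflection
  have hSr : S (R (r - p)) = r' - p' :=
    Submodule.reflection_sub (by rw [LinearIsometryEquiv.norm_map, hpr])
  have hSq : S (q' - p') = q' - p' := by
    rw [Submodule.reflection_eq_self_iff, Submodule.mem_orthogonal_singleton_iff_inner_left,
      inner_sub_right, ← hR, LinearIsometryEquiv.inner_map_map, hR,
      real_inner_eq_norm_mul_self_add_norm_mul_self_sub_norm_sub_mul_self_div_two,
      real_inner_eq_norm_mul_self_add_norm_mul_self_sub_norm_sub_mul_self_div_two,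
      sub_sub_sub_cancel_right, sub_sub_sub_cancel_right, hpq, hpr, hqr, sub_self]
  refine ⟨(IsometryEquiv.subRight p).trans
    (R.toIsometryEquiv.trans (S.toIsometryEquiv.trans (IsometryEquiv.addRight p'))), ?_, ?_, ?_⟩
  · simp
  · simp [hR, hSq]
  · change S (R (r - p)) + p' = r'
    rw [hSr, sub_add_cancel]

lemma norm_eq_of_exp_eq {E : Type*} [NormedAddCommGroup E] {t : ℝ} (ht : 0 < t) {x y : E}
    (h : Real.exp (-t * ‖x‖ ^ 2) = Real.exp (-t * ‖y‖ ^ 2)) : ‖x‖ = ‖y‖ := by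
  have h' : ‖x‖ ^ 2 = ‖y‖ ^ 2 := by
    have := Real.exp_injective h
    exact mul_left_cancel₀ (neg_ne_zero.mpr ht.ne') this
  exact (pow_left_inj₀ (norm_nonneg _) (norm_nonneg _) two_ne_zero).mp h'

/-- For `k = 2` and `k = 3`, equally weighted identity-covariance Gaussian mixtures with the
same distribution of distances have means that agree up to a rigid motion and a permutation,
with no genericity assumption on the means. -/
theorem two_and_three_component_mixtures_determined
    (d : ℕ) (hd : 1 ≤ d) :
    (∀ μ μbar : Fin 2 → EuclideanSpace ℝ (Fin d),
      distDistrib (gaussMixture (fun _ => (1 : ℝ) / 2) μ)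
          = distDistrib (gaussMixture (fun _ => (1 : ℝ) / 2) μbar) →
      ∃ (g : EuclideanSpace ℝ (Fin d) ≃ᵢ EuclideanSpace ℝ (Fin d)) (σ : Equiv.Perm (Fin 2)),
        ∀ i, μbar i = g (μ (σ i))) ∧
    (∀ μ μbar : Fin 3 → EuclideanSpace ℝ (Fin d),
      distDistrib (gaussMixture (fun _ => (1 : ℝ) / 3) μ)
          = distDistrib (gaussMixture (fun _ => (1 : ℝ) / 3) μbar) →
      ∃ (g : EuclideanSpace ℝ (Fin d) ≃ᵢ EuclideanSpace ℝ (Fin d)) (σ : Equiv.Perm (Fin 3)),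
        ∀ i, μbar i = g (μ (σ i))) := by
  constructor
  · intro μ ν h
    have e := sum_exp_eq_of_distDistrib_eq (t := 1 / 16) (by norm_num) (by norm_num)
      (by norm_num) h
    simp only [Fin.sum_univ_two, sub_self, norm_sub_rev (μ 1) (μ 0),
      norm_sub_rev (ν 1) (ν 0)] at e
    have hn : ‖μ 0 - μ 1‖ = ‖ν 0 - ν 1‖ :=
      norm_eq_of_exp_eq (t := 1 / 16) (by norm_num) (by linarith)
    obtain ⟨g, h0, h1, -⟩ := exists_isometryEquiv_of_norm_sub_eq (p := μ 1) (q := μ 0) (r := μ 1)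
      (p' := ν 1) (q' := ν 0) (r' := ν 1) hn (by simp) hn
    refine ⟨g, 1, fun i => ?_⟩
    fin_cases i
    · exact h1.symm
    · exact h0.symm
  · intro μ ν h
    set f : (Fin 3 → EuclideanSpace ℝ (Fin d)) → Fin 3 → Fin 3 → ℝ :=
      fun η i j => Real.exp (-(1 / 16) * ‖η i - η j‖ ^ 2) with hf
    have hpow : ∀ n : ℕ, 0 < n → n < 4 →
        f μ 1 2 ^ n + f μ 0 2 ^ n + f μ 0 1 ^ n = f ν 1 2 ^ n + f ν 0 2 ^ n + f ν 0 1 ^ n := by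
      intro n hn hn'
      have hn1 : (0 : ℝ) < n := by exact_mod_cast hn
      have hn2 : (n : ℝ) < 4 := by exact_mod_cast hn'
      have e := sum_exp_eq_of_distDistrib_eq (t := n * (1 / 16)) (by norm_num) (by positivity)
        (by linarith) h
      simp only [hf, ← Real.exp_nat_mul, ← mul_assoc, mul_neg, ← neg_mul]
      simp only [Fin.sum_univ_three, sub_self, norm_sub_rev (μ 1) (μ 0),
        norm_sub_rev (ν 1) (ν 0), norm_sub_rev (μ 2) (μ 0), norm_sub_rev (ν 2) (ν 0),
        norm_sub_rev (μ 2) (μ 1), norm_sub_rev (ν 2) (ν 1)] at e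
      simp only [neg_mul] at e ⊢
      linarith
    have hinj : ∀ i j k l, f μ i j = f ν k l → ‖μ i - μ j‖ = ‖ν k - ν l‖ := fun i j k l hij =>
      norm_eq_of_exp_eq (t := 1 / 16) (by norm_num) hij
    have hsss : ∀ σ : Equiv.Perm (Fin 3), ‖μ (σ 1) - μ (σ 2)‖ = ‖ν 1 - ν 2‖ →
        ‖μ (σ 0) - μ (σ 2)‖ = ‖ν 0 - ν 2‖ → ‖μ (σ 0) - μ (σ 1)‖ = ‖ν 0 - ν 1‖ →
        ∃ (g : EuclideanSpace ℝ (Fin d) ≃ᵢ EuclideanSpace ℝ (Fin d)) (σ : Equiv.Perm (Fin 3)),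
          ∀ i, ν i = g (μ (σ i)) := by
      intro σ h12 h02 h01
      obtain ⟨g, h0, h1, h2⟩ := exists_isometryEquiv_of_norm_sub_eq (p := μ (σ 2)) (q := μ (σ 0))
        (r := μ (σ 1)) (p' := ν 2) (q' := ν 0) (r' := ν 1) h02 h12 h01
      refine ⟨g, σ, fun i => ?_⟩
      fin_cases i
      · exact h1.symm
      · exact h2.symm
      · exact h0.symm
    have hp := perm_of_power_sums_eq (by simpa using hpow 1 (by norm_num) (by norm_num))
      (hpow 2 (by norm_num) (by norm_num)) (hpow 3 (by norm_num) (by norm_num))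
    have key : ∃ σ : Equiv.Perm (Fin 3), ‖μ (σ 1) - μ (σ 2)‖ = ‖ν 1 - ν 2‖ ∧
        ‖μ (σ 0) - μ (σ 2)‖ = ‖ν 0 - ν 2‖ ∧ ‖μ (σ 0) - μ (σ 1)‖ = ‖ν 0 - ν 1‖ := by
      have hμ := fun i j => norm_sub_rev (μ i) (μ j)
      rcases hp with ⟨ha, hb, hc⟩ | ⟨ha, hb, hc⟩ | ⟨ha, hb, hc⟩ | ⟨ha, hb, hc⟩ |
        ⟨ha, hb, hc⟩ | ⟨ha, hb, hc⟩ <;>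
      replace ha := hinj _ _ _ _ ha <;> replace hb := hinj _ _ _ _ hb <;>
      replace hc := hinj _ _ _ _ hc
      · exact ⟨1, ha, hb, hc⟩
      · exact ⟨Equiv.swap 1 2, (hμ 2 1).trans ha, hc, hb⟩
      · exact ⟨Equiv.swap 0 1, hb, ha, (hμ 1 0).trans hc⟩
      · exact ⟨(finRotate 3).symm, hc, (hμ 2 1).trans ha, (hμ 2 0).trans hb⟩
      · exact ⟨finRotate 3, (hμ 2 0).trans hb, (hμ 1 0).trans hc, ha⟩
      · exact ⟨Equiv.swap 0 2, (hμ 1 0).trans hc, (hμ 2 0).trans hb, (hμ 2 1).trans ha⟩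
    obtain ⟨σ, h12, h02, h01⟩ := key
    exact hsss σ h12 h02 h01
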